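/- Let μ = l_0 + l_2 be a curved symmetric graded Lie algebra structure on a ℤ-graded vector space E (a curved L∞-structure whose only components are a 0-form l_0 ∈ E_1 and a symmetric vector valued 2-form l_2 of degree +1), and let π ∈ E_0, viewed as a symmetric vector valued 0-form. Then π + S is a Nijenhuis vector valued form (with curvature) with respect to μ, with square 2π + S, if and only if π is a Poisson element, i.e. l_2(π,π) = 0. -/

import Mathlib

open scoped DirectSum
open Classical

noncomputable section

namespace RN

section Core

variable (𝕜 : Type) [Field 𝕜] [CharZero 𝕜]
variable (E : ℤ → Type) [∀ i, AddCommGroup (E i)] [∀ i, Module 𝕜 (E i)]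

/-- Raw vector-valued forms on the graded vector space `E`: for every arity `n` and every
vector of (input) degrees `ι`, a function on homogeneous tuples with values in the total
graded space `⨁ i, E i`. -/
abbrev RawForm : Type :=
  ∀ n : ℕ, ∀ ι : Fin n → ℤ, (∀ j, E (ι j)) → ⨁ i, E i

/-- Multilinearity (in each slot, on homogeneous arguments). -/
def IsMultilin (F : RawForm E) : Prop :=
  ∀ (n : ℕ) (ι : Fin n → ℤ) (x : ∀ j, E (ι j)) (j : Fin n) (a b : E (ι j)) (c : 𝕜),
    F n ι (Function.update x j (a + b)) =
        F n ι (Function.update x j a) + F n ι (Function.update x j b) ∧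
      F n ι (Function.update x j (c • a)) = c • F n ι (Function.update x j a)

/-- Graded symmetry: swapping two adjacent homogeneous arguments multiplies the value
by the Koszul sign `(-1)^{|X||Y|}`. -/
def IsGradedSym (F : RawForm E) : Prop :=
  ∀ (n : ℕ) (ι : Fin n → ℤ) (x : ∀ j, E (ι j)) (p q : Fin n), (p : ℕ) + 1 = (q : ℕ) →
    F n (fun j => ι (Equiv.swap p q j)) (fun j => x (Equiv.swap p q j)) =
      ((-1 : 𝕜) ^ (ι p * ι q)) • F n ι x

/-- `F` has degree `d`: its value on homogeneous arguments of degrees `ι` is homogeneous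
of degree `(∑ j, ι j) + d`. -/
def IsOfDeg (d : ℤ) (F : RawForm E) : Prop :=
  ∀ (n : ℕ) (ι : Fin n → ℤ) (x : ∀ j, E (ι j)) (m : ℤ),
    m ≠ (∑ j, ι j) + d → F n ι x m = 0

/-- Symmetric vector valued form of degree `d`. -/
def IsSVF (d : ℤ) (F : RawForm E) : Prop :=
  IsMultilin 𝕜 E F ∧ IsGradedSym 𝕜 E F ∧ IsOfDeg E d F

/-- `F` is (concentrated in) a `k`-form. -/
def IsArity (k : ℕ) (F : RawForm E) : Prop :=
  ∀ n, n ≠ k → ∀ (ι : Fin n → ℤ) (x : ∀ j, E (ι j)), F n ι x = 0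

/-- `F` has no 0-form (curvature) component. -/
def NoCurv (F : RawForm E) : Prop :=
  ∀ (ι : Fin 0 → ℤ) (x : ∀ j, E (ι j)), F 0 ι x = 0

/-- `(k, n-k)`-shuffles of `Fin n`. -/
def IsShuffle (k : ℕ) {n : ℕ} (σ : Equiv.Perm (Fin n)) : Prop :=
  ∀ i j : Fin n, i < j → ((j : ℕ) < k ∨ k ≤ (i : ℕ)) → σ i < σ j

/-- The Koszul sign of the rearrangement `(X_{σ(1)},…,X_{σ(n)})` of homogeneous elements
of degrees `ι`. -/
def koszulSign {n : ℕ} (ι : Fin n → ℤ) (σ : Equiv.Perm (Fin n)) : 𝕜 :=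
  ∏ p ∈ Finset.univ.filter (fun p : Fin n × Fin n => p.1 < p.2 ∧ σ p.2 < σ p.1),
    (-1 : 𝕜) ^ (ι (σ p.1) * ι (σ p.2))

/-- Prepend a degree to a vector of degrees. -/
def dcons {n : ℕ} (m : ℤ) (rest : Fin n → ℤ) : Fin (n + 1) → ℤ :=
  fun j => if h : (j : ℕ) = 0 then m else rest ⟨(j : ℕ) - 1, by have := j.isLt; omega⟩

/-- Prepend a homogeneous element to a tuple of homogeneous elements. -/
def dconsV {n : ℕ} {m : ℤ} {rest : Fin n → ℤ} (v : E m) (xs : ∀ i, E (rest i)) :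
    ∀ j : Fin (n + 1), E (dcons m rest j) := fun j => by
  unfold dcons
  by_cases h : (j : ℕ) = 0
  · rw [dif_pos h]; exact v
  · rw [dif_neg h]; exact xs ⟨(j : ℕ) - 1, by have := j.isLt; omega⟩

/-- The insertion operator `ι_F G`, summing over shuffles with Koszul signs. -/
def ins (F G : RawForm E) : RawForm E :=
  fun n ι x =>
    ∑ k : Fin (n + 1),
      ∑ σ ∈ Finset.univ.filter (fun σ : Equiv.Perm (Fin n) => IsShuffle (k : ℕ) σ),
        koszulSign 𝕜 ι σ •
          DFinsupp.sum
            (F (k : ℕ)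
              (fun i => ι (σ ⟨(i : ℕ), by have h1 := i.isLt; have h2 := k.isLt; omega⟩))
              (fun i => x (σ ⟨(i : ℕ), by have h1 := i.isLt; have h2 := k.isLt; omega⟩)))
            (fun m v =>
              G (n - (k : ℕ) + 1)
                (dcons m
                  (fun i => ι (σ ⟨(k : ℕ) + (i : ℕ), by have h1 := i.isLt; have h2 := k.isLt; omega⟩)))
                (dconsV E v
                  (fun i => x (σ ⟨(k : ℕ) + (i : ℕ), by have h1 := i.isLt; have h2 := k.isLt; omega⟩))))

/-- The Richardson–Nijenhuis bracket `[F,G]_RN = ι_F G - (-1)^{dK·dL} ι_G F` of forms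
of degrees `dK` and `dL`. -/
def rnb (dK dL : ℤ) (F G : RawForm E) : RawForm E :=
  fun n ι x => ins 𝕜 E F G n ι x - ((-1 : 𝕜) ^ (dK * dL)) • ins 𝕜 E G F n ι x

/-- An element of the graded vector space, regarded as a vector valued 0-form. -/
def ofElem (v : ⨁ i, E i) : RawForm E := fun n _ _ => if n = 0 then v else 0

/-- The Euler map `S(X) = -|X|·X`, a vector valued 1-form of degree 0. -/
def euler : RawForm E :=
  fun n ι x =>
    if h : n = 1 then
      (-(ι ⟨0, by omega⟩)) • DirectSum.of E (ι ⟨0, by omega⟩) (x ⟨0, by omega⟩)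
    else 0

/-- The identity map of `E`, regarded as a vector valued 1-form of degree 0. -/
def idF : RawForm E :=
  fun n ι x =>
    if h : n = 1 then DirectSum.of E (ι ⟨0, by omega⟩) (x ⟨0, by omega⟩) else 0

/-- The arity-`k` component of a vector valued form. -/
def comp (F : RawForm E) (k : ℕ) : RawForm E :=
  fun n ι x => if n = k then F n ι x else 0

end Core

section Aux

variable {𝕜 : Type} [Field 𝕜]
variable {E : ℤ → Type}

theorem heq_apply {α : Type*} {β : α → Type*} (x : ∀ j, β j) {i j : α} (h : i = j) :
    HEq (x i) (x j) := by
  subst h; rfl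

theorem dconsV_zero {n : ℕ} {m : ℤ} {ι : Fin n → ℤ} (v : E m) (xs : ∀ i, E (ι i))
    (j : Fin (n + 1)) (h : (j : ℕ) = 0) : HEq (dconsV E v xs j) v := by
  simp only [dconsV, h, dite_true]
  exact cast_heq _ _

theorem dcons_succ {n : ℕ} {m : ℤ} {ι : Fin n → ℤ}
    (j : Fin (n + 1)) (i : Fin n) (h : (j : ℕ) = i + 1) : dcons m ι j = ι i := by
  simp [dcons, h]

theorem dconsV_succ {n : ℕ} {m : ℤ} {ι : Fin n → ℤ} (v : E m) (xs : ∀ i, E (ι i))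
    (j : Fin (n + 1)) (i : Fin n) (h : (j : ℕ) = i + 1) : HEq (dconsV E v xs j) (xs i) := by
  have h0 : (j : ℕ) ≠ 0 := by omega
  have : (⟨(j : ℕ) - 1, by have := j.isLt; omega⟩ : Fin n) = i := Fin.ext (by simp [h])
  simp only [dconsV, h0, dite_false]
  refine HEq.trans (cast_heq _ _) (heq_apply xs this)

theorem dconsV_eq_update {n : ℕ} {m : ℤ} {ι : Fin n → ℤ} (v w : E m) (xs : ∀ i, E (ι i)) :
    dconsV E w xs = Function.update (dconsV E v xs) 0 w := by
  funext j
  by_cases h : j = 0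
  · subst h
    exact (eq_of_heq (dconsV_zero w xs 0 rfl)).trans
      (Function.update_self (β := fun j => E (dcons m ι j)) 0 w (dconsV E v xs)).symm
  · refine Eq.trans ?_
      (Function.update_of_ne (β := fun j => E (dcons m ι j)) h w (dconsV E v xs)).symm
    obtain ⟨i, rfl⟩ := Fin.exists_succ_eq.2 h
    exact eq_of_heq ((dconsV_succ w xs _ i (by simp)).trans (dconsV_succ v xs _ i (by simp)).symm)

variable [∀ i, AddCommGroup (E i)] [∀ i, Module 𝕜 (E i)]

theorem RawForm.congr_heq (G : RawForm E) {n n' : ℕ} (hn : n = n')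
    {ι : Fin n → ℤ} {ι' : Fin n' → ℤ} {x : ∀ j, E (ι j)} {x' : ∀ j, E (ι' j)}
    (h : ∀ (i : Fin n) (i' : Fin n'), (i : ℕ) = i' → ι i = ι' i' ∧ HEq (x i) (x' i')) :
    G n ι x = G n' ι' x' := by
  subst hn
  obtain rfl : ι = ι' := funext fun i => (h i i rfl).1
  obtain rfl : x = x' := funext fun i => eq_of_heq (h i i rfl).2
  rfl

theorem RawForm.congr_dconsV (G : RawForm E) {n n' : ℕ} (hn : n = n') {m : ℤ} (v : E m)
    {ι : Fin n → ℤ} {ι' : Fin n' → ℤ} {x : ∀ j, E (ι j)} {x' : ∀ j, E (ι' j)}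
    (h : ∀ (i : Fin n) (i' : Fin n'), (i : ℕ) = i' → ι i = ι' i' ∧ HEq (x i) (x' i')) :
    G (n + 1) (dcons m ι) (dconsV E v x) = G (n' + 1) (dcons m ι') (dconsV E v x') := by
  subst hn
  obtain rfl : ι = ι' := funext fun i => (h i i rfl).1
  obtain rfl : x = x' := funext fun i => eq_of_heq (h i i rfl).2
  rfl

theorem IsMultilin.map_update_zsmul {G : RawForm E} (hG : IsMultilin 𝕜 E G) {n : ℕ}
    {ι : Fin n → ℤ} (x : ∀ j, E (ι j)) (j : Fin n) (c : ℤ) (a : E (ι j)) :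
    G n ι (Function.update x j (c • a)) = c • G n ι (Function.update x j a) := by
  rw [← Int.cast_smul_eq_zsmul 𝕜, ← Int.cast_smul_eq_zsmul 𝕜]
  exact (hG n ι x j a a c).2

theorem IsMultilin.map_dconsV_zsmul {G : RawForm E} (hG : IsMultilin 𝕜 E G) {n : ℕ}
    {m : ℤ} {ι : Fin n → ℤ} (c : ℤ) (v : E m) (xs : ∀ i, E (ι i)) :
    G (n + 1) (dcons m ι) (dconsV E (c • v) xs) =
      c • G (n + 1) (dcons m ι) (dconsV E v xs) := by
  rw [dconsV_eq_update v (c • v)]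
  conv_rhs => rw [dconsV_eq_update v v]
  exact hG.map_update_zsmul (ι := dcons m ι) (dconsV E v xs) 0 c v

theorem IsMultilin.map_dconsV_zero {G : RawForm E} (hG : IsMultilin 𝕜 E G) {n : ℕ}
    {m : ℤ} {ι : Fin n → ℤ} (xs : ∀ i, E (ι i)) :
    G (n + 1) (dcons m ι) (dconsV E (0 : E m) xs) = 0 := by
  simpa using hG.map_dconsV_zsmul 0 (0 : E m) xs

theorem IsMultilin.sum_of_dconsV {G : RawForm E} (hG : IsMultilin 𝕜 E G) {n : ℕ}
    {m : ℤ} {ι : Fin n → ℤ} (v : E m) (xs : ∀ i, E (ι i)) :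
    DFinsupp.sum (DirectSum.of E m v) (fun m v => G (n + 1) (dcons m ι) (dconsV E v xs)) =
      G (n + 1) (dcons m ι) (dconsV E v xs) :=
  DFinsupp.sum_single_index (h := fun m v => G (n + 1) (dcons m ι) (dconsV E v xs))
    (hG.map_dconsV_zero xs)

theorem isShuffle_one {n : ℕ} (k : ℕ) : IsShuffle k (1 : Equiv.Perm (Fin n)) :=
  fun _ _ h _ => h

theorem eq_one_of_strictMono {n : ℕ} {σ : Equiv.Perm (Fin n)} (h : StrictMono σ) : σ = 1 := by
  have := Subsingleton.elim
    (StrictMono.orderIsoOfSurjective σ h σ.surjective) (OrderIso.refl (Fin n))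
  ext i
  simpa using congrArg (fun f : Fin n ≃o Fin n => (f i : ℕ)) this

theorem filter_isShuffle_zero (n : ℕ) :
    Finset.univ.filter (fun σ : Equiv.Perm (Fin n) => IsShuffle 0 σ) = {1} := by
  ext σ
  simp only [Finset.mem_filter, Finset.mem_univ, true_and, Finset.mem_singleton]
  refine ⟨fun h => eq_one_of_strictMono fun i j hij => h i j hij (Or.inr (Nat.zero_le _)), ?_⟩
  rintro rfl
  exact isShuffle_one _

theorem filter_isShuffle_self (n : ℕ) :
    Finset.univ.filter (fun σ : Equiv.Perm (Fin n) => IsShuffle n σ) = {1} := by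
  ext σ
  simp only [Finset.mem_filter, Finset.mem_univ, true_and, Finset.mem_singleton]
  refine ⟨fun h => eq_one_of_strictMono fun i j hij => h i j hij (Or.inl j.isLt), ?_⟩
  rintro rfl
  exact isShuffle_one _

theorem koszulSign_one {n : ℕ} (ι : Fin n → ℤ) : koszulSign 𝕜 ι 1 = 1 := by
  unfold koszulSign
  rw [Finset.filter_false_of_mem]
  · rfl
  · rintro p - ⟨h, h'⟩
    exact lt_asymm h h'

theorem koszulSign_swap (ι : Fin 2 → ℤ) :
    koszulSign 𝕜 ι (Equiv.swap 0 1) = (-1 : 𝕜) ^ (ι 1 * ι 0) := by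
  have : (Finset.univ.filter (fun p : Fin 2 × Fin 2 =>
      p.1 < p.2 ∧ Equiv.swap 0 1 p.2 < Equiv.swap (0 : Fin 2) 1 p.1)) = {(0, 1)} := by decide
  unfold koszulSign
  rw [Finset.prod_congr (s₂ := {(0, 1)}) (by convert this) fun _ _ => rfl]
  simp

variable (𝕜) in
/-- The part of `ins F G` in which `F` takes `k` arguments. -/
def insTerm (F G : RawForm E) (n : ℕ) (k : Fin (n + 1)) (ι : Fin n → ℤ) (x : ∀ j, E (ι j)) :
    ⨁ i, E i :=
  ∑ σ ∈ Finset.univ.filter (fun σ : Equiv.Perm (Fin n) => IsShuffle (k : ℕ) σ),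
    koszulSign 𝕜 ι σ •
      DFinsupp.sum
        (F (k : ℕ)
          (fun i => ι (σ ⟨(i : ℕ), by have h1 := i.isLt; have h2 := k.isLt; omega⟩))
          (fun i => x (σ ⟨(i : ℕ), by have h1 := i.isLt; have h2 := k.isLt; omega⟩)))
        (fun m v =>
          G (n - (k : ℕ) + 1)
            (dcons m
              (fun i => ι (σ ⟨(k : ℕ) + (i : ℕ), by have h1 := i.isLt; have h2 := k.isLt; omega⟩)))
            (dconsV E v
              (fun i => x (σ ⟨(k : ℕ) + (i : ℕ), by have h1 := i.isLt; have h2 := k.isLt; omega⟩))))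

theorem ins_eq_sum_insTerm (F G : RawForm E) (n : ℕ) (ι : Fin n → ℤ) (x : ∀ j, E (ι j)) :
    ins 𝕜 E F G n ι x = ∑ k, insTerm 𝕜 F G n k ι x := rfl

theorem insTerm_of_left_zero (F G : RawForm E) (n : ℕ) (k : Fin (n + 1))
    (hF : ∀ ι x, F k ι x = 0) (ι : Fin n → ℤ) (x : ∀ j, E (ι j)) :
    insTerm 𝕜 F G n k ι x = 0 := by
  simp [insTerm, hF, DFinsupp.sum_zero_index]

theorem insTerm_of_right_zero (F G : RawForm E) (n : ℕ) (k : Fin (n + 1))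
    (hG : ∀ ι x, G (n - k + 1) ι x = 0) (ι : Fin n → ℤ) (x : ∀ j, E (ι j)) :
    insTerm 𝕜 F G n k ι x = 0 := by
  simp [insTerm, hG, DFinsupp.sum]

/-- The form `π + S`. -/
def elemAddEuler (π : E 0) : RawForm E := ofElem E (DirectSum.of E 0 π) + euler E

theorem elemAddEuler_zero (π : E 0) (ι : Fin 0 → ℤ) (x : ∀ j, E (ι j)) :
    elemAddEuler π 0 ι x = DirectSum.of E 0 π := by
  simp [elemAddEuler, ofElem, euler]

theorem elemAddEuler_one (π : E 0) (ι : Fin 1 → ℤ) (x : ∀ j, E (ι j)) :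
    elemAddEuler π 1 ι x = DirectSum.of E (ι 0) ((-ι 0) • x 0) := by
  rw [map_zsmul]
  simp [elemAddEuler, ofElem, euler]

theorem elemAddEuler_of_two_le (π : E 0) {n : ℕ} (hn : 2 ≤ n) (ι : Fin n → ℤ)
    (x : ∀ j, E (ι j)) : elemAddEuler π n ι x = 0 := by
  have h0 : n ≠ 0 := by omega
  have h1 : n ≠ 1 := by omega
  simp [elemAddEuler, ofElem, euler, h0, h1]

/-- The insertion of a homogeneous element as first argument. -/
def insElem (π : E 0) (G : RawForm E) : RawForm E :=
  fun n ι x => G (n + 1) (dcons 0 ι) (dconsV E π x)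

theorem insTerm_elemAddEuler_zero (π : E 0) {G : RawForm E} (hG : IsMultilin 𝕜 E G) (n : ℕ)
    (ι : Fin n → ℤ) (x : ∀ j, E (ι j)) :
    insTerm 𝕜 (elemAddEuler π) G n 0 ι x = insElem π G n ι x := by
  unfold insTerm
  refine (Finset.sum_congr (filter_isShuffle_zero n) fun _ _ => rfl).trans ?_
  rw [Finset.sum_singleton, koszulSign_one, one_smul]
  refine (congrArg (fun f => DFinsupp.sum f _) (elemAddEuler_zero π _ _)).trans ?_
  refine (hG.sum_of_dconsV _ _).trans ?_
  refine RawForm.congr_dconsV G (Nat.sub_zero n) π fun i i' h => ?_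
  have hi : ∀ hl, (⟨((0 : Fin (n + 1)) : ℕ) + i, hl⟩ : Fin n) = i' := fun _ => Fin.ext (by simp [h])
  exact ⟨congrArg ι (hi _), heq_apply x (hi _)⟩

theorem insTerm_elemAddEuler_one_one (π : E 0) {G : RawForm E} (hG : IsMultilin 𝕜 E G)
    (ι : Fin 1 → ℤ) (x : ∀ j, E (ι j)) :
    insTerm 𝕜 (elemAddEuler π) G 1 1 ι x = (-∑ j, ι j) • G 1 ι x := by
  unfold insTerm
  refine (Finset.sum_congr (filter_isShuffle_self 1) fun _ _ => rfl).trans ?_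
  rw [Finset.sum_singleton, koszulSign_one, one_smul]
  refine (congrArg (fun f => DFinsupp.sum f _) (elemAddEuler_one π _ _)).trans ?_
  refine (hG.sum_of_dconsV _ _).trans ?_
  refine (hG.map_dconsV_zsmul _ _ _).trans ?_
  rw [Fin.sum_univ_one]
  refine congrArg (fun z => (-ι 0) • z) 
    (RawForm.congr_heq (n' := 1) G (by simp) fun i i' h => ?_)
  obtain rfl := Subsingleton.elim i' 0
  exact ⟨by simp [dcons], dconsV_zero _ _ _ h⟩

theorem insTerm_elemAddEuler_two_one (π : E 0) {G : RawForm E} (hG : IsMultilin 𝕜 E G)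
    (hs : IsGradedSym 𝕜 E G) (ι : Fin 2 → ℤ) (x : ∀ j, E (ι j)) :
    insTerm 𝕜 (elemAddEuler π) G 2 1 ι x = (-∑ j, ι j) • G 2 ι x := by
  have hf : Finset.univ.filter (fun σ : Equiv.Perm (Fin 2) => IsShuffle 1 σ) =
      {1, Equiv.swap 0 1} := by
    have hu : (Finset.univ : Finset (Equiv.Perm (Fin 2))) = {1, Equiv.swap 0 1} := by decide
    rw [Finset.filter_true_of_mem]
    · convert hu
    · intro σ _ i j hij h
      omega
  have key : ∀ σ : Equiv.Perm (Fin 2),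
      DFinsupp.sum
        (elemAddEuler π 1 (fun i => ι (σ ⟨(i : ℕ), by have h1 := i.isLt; omega⟩))
          (fun i => x (σ ⟨(i : ℕ), by have h1 := i.isLt; omega⟩)))
        (fun m v => G (2 - 1 + 1)
            (dcons m (fun i => ι (σ ⟨1 + (i : ℕ), by have h1 := i.isLt; omega⟩)))
            (dconsV E v (fun i => x (σ ⟨1 + (i : ℕ), by have h1 := i.isLt; omega⟩)))) =
      (-ι (σ 0)) • G 2 (fun j => ι (σ j)) (fun j => x (σ j)) := by
    intro σ
    rw [elemAddEuler_one]
    refine (hG.sum_of_dconsV _ _).trans ?_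
    refine (hG.map_dconsV_zsmul _ _ _).trans ?_
    refine congrArg (fun z => (-ι (σ 0)) • z) (RawForm.congr_heq G rfl fun i i' h => ?_)
    obtain rfl := Fin.ext h
    refine Fin.cases ⟨rfl, ?_⟩ (fun j => ⟨?_, ?_⟩) i
    · exact dconsV_zero _ _ _ rfl
    · rw [dcons_succ j.succ j (by simp)]
      congr 2
      ext; simp [add_comm]
    · refine (dconsV_succ _ _ _ j (by simp)).trans (heq_apply x ?_)
      congr 1
      ext; simp [add_comm]
  unfold insTerm
  have hne : (1 : Equiv.Perm (Fin 2)) ∉ ({Equiv.swap 0 1} : Finset (Equiv.Perm (Fin 2))) := by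
    decide
  refine (Finset.sum_congr hf fun σ _ => congrArg (koszulSign 𝕜 ι σ • ·) (key σ)).trans ?_
  rw [Finset.sum_insert (by convert hne), Finset.sum_singleton, koszulSign_one, koszulSign_swap,
    hs 2 ι x 0 1 rfl, smul_comm ((-1 : 𝕜) ^ _), smul_smul ((-1 : 𝕜) ^ _), mul_comm (ι 1),
    ← mul_zpow, Fin.sum_univ_two, one_smul]
  simp only [Equiv.Perm.one_apply, Equiv.swap_apply_left, neg_neg, mul_neg, mul_one,
    one_zpow, one_smul]
  module

theorem ins_elemAddEuler_left (π : E 0) {G : RawForm E} (hG : IsMultilin 𝕜 E G)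
    (hs : IsGradedSym 𝕜 E G) (h3 : ∀ n, 3 ≤ n → ∀ ι x, G n ι x = 0)
    (n : ℕ) (ι : Fin n → ℤ) (x : ∀ j, E (ι j)) :
    ins 𝕜 E (elemAddEuler π) G n ι x = insElem π G n ι x - (∑ j, ι j) • G n ι x := by
  rw [ins_eq_sum_insTerm]
  match n, ι, x with
  | 0, ι, x => simp [insTerm_elemAddEuler_zero π hG]
  | 1, ι, x =>
    rw [Fin.sum_univ_two, insTerm_elemAddEuler_zero π hG, insTerm_elemAddEuler_one_one π hG]
    rw [neg_smul, sub_eq_add_neg]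
  | 2, ι, x =>
    rw [Fin.sum_univ_three, insTerm_elemAddEuler_zero π hG, insTerm_elemAddEuler_two_one π hG hs,
      insTerm_of_left_zero _ _ _ 2 (elemAddEuler_of_two_le π le_rfl), add_zero]
    rw [neg_smul, sub_eq_add_neg]
  | n + 3, ι, x =>
    rw [insElem, h3 _ (by omega), h3 _ (by omega), smul_zero, sub_zero]
    refine Finset.sum_eq_zero fun k _ => ?_
    by_cases hk : 2 ≤ (k : ℕ)
    · exact insTerm_of_left_zero _ _ _ _ (elemAddEuler_of_two_le π hk) _ _
    · exact insTerm_of_right_zero _ _ _ _ (h3 _ (by omega)) _ _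

theorem sum_zsmul_of_degree (f : ⨁ i, E i) (e : ℤ) (hf : ∀ m, m ≠ e → f m = 0) :
    DFinsupp.sum f (fun m v => (-m) • DirectSum.of E m v) = (-e) • f := by
  conv_rhs => rw [← DirectSum.sum_support_of f, Finset.smul_sum]
  unfold DFinsupp.sum
  refine Finset.sum_congr rfl fun m hm => ?_
  by_cases h : m = e
  · rw [h]
  · exact absurd (hf m h) (DFinsupp.mem_support_iff.1 hm)

theorem ins_elemAddEuler_right (π : E 0) {d : ℤ} {G : RawForm E} (hd : IsOfDeg E d G)
    (n : ℕ) (ι : Fin n → ℤ) (x : ∀ j, E (ι j)) :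
    ins 𝕜 E G (elemAddEuler π) n ι x = -((∑ j, ι j) + d) • G n ι x := by
  rw [ins_eq_sum_insTerm, Finset.sum_eq_single (Fin.last n)]
  · rw [← sum_zsmul_of_degree _ _ (hd n ι x)]
    unfold insTerm
    simp only [Fin.val_last, filter_isShuffle_self, Finset.sum_singleton,
      koszulSign_one, one_smul]
    refine congrArg (DFinsupp.sum (G n ι x)) ?_
    funext m v
    refine (RawForm.congr_heq (n' := 1) (ι' := fun _ => m) (x' := fun _ => v) _ (by simp)
      fun i i' h => ?_).trans ((elemAddEuler_one _ _ _).trans (map_zsmul _ _ _))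
    have h0 : (i : ℕ) = 0 := by omega
    refine ⟨by simp [dcons, h0], dconsV_zero _ _ _ h0⟩
  · intro k _ hk
    have : (k : ℕ) < n := Fin.val_lt_last hk
    exact insTerm_of_right_zero _ _ _ _ (elemAddEuler_of_two_le π (by omega)) _ _
  · simp

/-- Bracketing with `π + S` is insertion of `π` plus multiplication by the degree. -/
theorem rnb_elemAddEuler (π : E 0) {d : ℤ} {G : RawForm E} (hG : IsSVF 𝕜 E d G)
    (h3 : ∀ n, 3 ≤ n → ∀ ι x, G n ι x = 0) :
    rnb 𝕜 E 0 d (elemAddEuler π) G = insElem π G + d • G := by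
  funext n ι x
  rw [rnb, ins_elemAddEuler_left π hG.1 hG.2.1 h3, ins_elemAddEuler_right π hG.2.2]
  simp only [zero_mul, zpow_zero, one_smul, Pi.add_apply, Pi.smul_apply]
  module

theorem IsSVF.add {d : ℤ} {F G : RawForm E} (hF : IsSVF 𝕜 E d F) (hG : IsSVF 𝕜 E d G) :
    IsSVF 𝕜 E d (F + G) := by
  refine ⟨fun n ι x j a b c => ?_, fun n ι x p q h => ?_, fun n ι x m h => ?_⟩
  · simp only [Pi.add_apply, (hF.1 n ι x j a b c).1, (hG.1 n ι x j a b c).1,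
      (hF.1 n ι x j a b c).2, (hG.1 n ι x j a b c).2, smul_add, and_true]
    abel
  · simp only [Pi.add_apply, hF.2.1 n ι x p q h, hG.2.1 n ι x p q h, smul_add]
  · simp only [Pi.add_apply, DirectSum.add_apply, hF.2.2 n ι x m h, hG.2.2 n ι x m h, add_zero]

theorem isSVF_ofElem {d : ℤ} (C : E d) : IsSVF 𝕜 E d (ofElem E (DirectSum.of E d C)) := by
  refine ⟨fun n ι x j a b c => ?_, fun n ι x p q h => ?_, fun n ι x m h => ?_⟩
  · have : n ≠ 0 := by have := j.isLt; omega
    simp [ofElem, this]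
  · have : n ≠ 0 := by have := p.isLt; omega
    simp [ofElem, this]
  · rcases Nat.eq_zero_or_pos n with rfl | hn
    · rw [Finset.univ_eq_empty, Finset.sum_empty, zero_add] at h
      simpa [ofElem] using DirectSum.of_eq_of_ne _ _ _ h
    · simp [ofElem, hn.ne']

theorem isSVF_of_isArity_one {d : ℤ} {F : RawForm E} (hF : IsArity E 1 F)
    (hadd : ∀ (ι : Fin 1 → ℤ) (x : ∀ j, E (ι j)) (a b : E (ι 0)),
      F 1 ι (Function.update x 0 (a + b)) =
        F 1 ι (Function.update x 0 a) + F 1 ι (Function.update x 0 b))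
    (hsmul : ∀ (ι : Fin 1 → ℤ) (x : ∀ j, E (ι j)) (a : E (ι 0)) (c : 𝕜),
      F 1 ι (Function.update x 0 (c • a)) = c • F 1 ι (Function.update x 0 a))
    (hdeg : ∀ (ι : Fin 1 → ℤ) (x : ∀ j, E (ι j)) (m : ℤ), m ≠ ι 0 + d → F 1 ι x m = 0) :
    IsSVF 𝕜 E d F := by
  refine ⟨fun n ι x j a b c => ?_, fun n ι x p q h => ?_, fun n ι x m h => ?_⟩
  · by_cases hn : n = 1
    · subst hn
      obtain rfl := Subsingleton.elim j 0
      exact ⟨hadd _ _ _ _, hsmul _ _ _ _⟩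
    · simp [hF n hn]
  · rw [hF n (by omega), hF n (by omega), smul_zero]
  · by_cases hn : n = 1
    · subst hn
      exact hdeg ι x m (by simpa using h)
    · simp [hF n hn]

theorem isSVF_euler : IsSVF 𝕜 E 0 (euler E) := by
  refine isSVF_of_isArity_one (fun n hn ι x => by simp [euler, hn]) (fun ι x a b => ?_)
    (fun ι x a c => ?_) (fun ι x m h => ?_)
  · simp [euler]
  · simp only [euler, dite_true]
    have h : ∀ y : E (ι 0), (Function.update x 0 y) ⟨0, by omega⟩ = y := fun y =>
      Function.update_self (f := x) 0 y
    rw [h, h]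
    have : DirectSum.of E (ι 0) (c • a) = c • DirectSum.of E (ι 0) a :=
      (DirectSum.lof 𝕜 ℤ E (ι 0)).map_smul c a
    refine (congrArg _ this).trans (smul_comm _ _ _)
  · have := DirectSum.of_eq_of_ne (β := E) _ _ (x 0) (show m ≠ ι 0 by simpa using h)
    simp only [euler, dite_true]
    rw [DirectSum.smul_apply]
    exact (congrArg _ this).trans (smul_zero _)

theorem isSVF_insElem (π : E 0) {d : ℤ} {G : RawForm E} (hG : IsSVF 𝕜 E d G)
    (ha : IsArity E 2 G) : IsSVF 𝕜 E d (insElem π G) := by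
  have hu : ∀ (ι : Fin 1 → ℤ) (x : ∀ j, E (ι j)) (a : E (ι 0)),
      dconsV E π (Function.update x 0 a) =
        Function.update (dconsV E π x) 1 (a : E (dcons 0 ι 1)) := by
    intro ι x a
    funext j
    match j with
    | 0 => rfl
    | 1 =>
      exact (eq_of_heq ((dconsV_succ _ _ 1 0 rfl).trans
        (heq_of_eq (Function.update_self _ _ _)))).trans
        (Function.update_self (β := fun j => E (dcons 0 ι j)) 1 a (dconsV E π x)).symm
  refine isSVF_of_isArity_one (fun n hn ι x => ha _ (by omega) _ _) (fun ι x a b => ?_)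
    (fun ι x a c => ?_) (fun ι x m h => ?_)
  · simp only [insElem, hu]
    exact (hG.1 2 (dcons 0 ι) (dconsV E π x) 1 a b 0).1
  · simp only [insElem, hu]
    exact (hG.1 2 (dcons 0 ι) (dconsV E π x) 1 a a c).2
  · refine hG.2.2 2 _ _ m ?_
    simpa [Fin.sum_univ_two, dcons] using h

end Aux

/-- Let `μ = l₀ + l₂` be a curved symmetric graded Lie algebra structure
on `E` (a curved `L∞`-structure whose only components are a 0-form `l₀ = C ∈ E₁` and a
symmetric vector valued 2-form `l₂` of degree `+1`), and `π ∈ E₀`.  Then `π + S` is a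
Nijenhuis vector valued form (with curvature) with respect to `μ`, with square `2π + S`,
iff `π` is a Poisson element, i.e. `l₂(π,π) = 0`. -/
theorem statement12 (𝕜 : Type) [Field 𝕜] [CharZero 𝕜]
    (E : ℤ → Type) [∀ i, AddCommGroup (E i)] [∀ i, Module 𝕜 (E i)]
    (C : E 1) (l2 : RawForm E) (h2 : IsSVF 𝕜 E 1 l2) (h2a : IsArity E 2 l2)
    (μ : RawForm E) (hμ : μ = ofElem E (DirectSum.of E 1 C) + l2)
    (hμμ : rnb 𝕜 E 1 1 μ μ = 0) (π : E 0) :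
    (rnb 𝕜 E 0 1 (ofElem E (DirectSum.of E 0 π) + euler E)
          (rnb 𝕜 E 0 1 (ofElem E (DirectSum.of E 0 π) + euler E) μ) =
        rnb 𝕜 E 0 1 ((2 : ℤ) • ofElem E (DirectSum.of E 0 π) + euler E) μ ∧
      rnb 𝕜 E 0 0 (ofElem E (DirectSum.of E 0 π) + euler E)
        ((2 : ℤ) • ofElem E (DirectSum.of E 0 π) + euler E) = 0) ↔
      l2 2 (fun _ => (0 : ℤ)) (fun _ => π) = 0 := by
  have hN : ofElem E (DirectSum.of E 0 π) + euler E = elemAddEuler π := rfl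
  have hK : (2 : ℤ) • ofElem E (DirectSum.of E 0 π) + euler E = elemAddEuler ((2 : ℤ) • π) := by
    rw [elemAddEuler, map_zsmul]
    congr 1
    funext n ι x
    by_cases h : n = 0 <;> simp [ofElem, h]
  have hμs : IsSVF 𝕜 E 1 μ := hμ ▸ (isSVF_ofElem C).add h2
  have hμ3 : ∀ n, 3 ≤ n → ∀ ι x, μ n ι x = 0 := by
    intro n hn ι x
    have : n ≠ 0 := by omega
    simp [hμ, ofElem, this, h2a n (by omega)]
  have hins : ∀ π : E 0, insElem π μ = insElem π l2 := by
    intro π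
    funext n ι x
    simp [hμ, insElem, ofElem]
  have hB := isSVF_insElem π h2 h2a
  have hB3 : ∀ n, 3 ≤ n → ∀ ι x, (insElem π l2 + μ) n ι x = 0 := fun n hn ι x => by
    simp [hμ3 n hn, insElem, h2a (n + 1) (by omega)]
  have hππ : insElem π (insElem π l2) =
      ofElem E (l2 2 (fun _ => (0 : ℤ)) (fun _ => π)) := by
    funext n ι x
    by_cases h : n = 0
    · subst h
      simp only [insElem, ofElem, if_true]
      refine RawForm.congr_heq l2 rfl fun i i' h => ?_
      match i with
      | 0 => exact ⟨rfl, dconsV_zero _ _ _ rfl⟩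
      | 1 => exact ⟨rfl, (dconsV_succ _ _ 1 0 rfl).trans (dconsV_zero _ _ _ rfl)⟩
    · simp [insElem, ofElem, h, h2a (n + 1 + 1) (by omega)]
  have h2π : insElem ((2 : ℤ) • π) l2 = (2 : ℤ) • insElem π l2 := by
    funext n ι x
    exact h2.1.map_dconsV_zsmul 2 π x
  have hadd : insElem π (insElem π l2 + μ) = insElem π (insElem π l2) + insElem π μ := rfl
  have hsq : rnb 𝕜 E 0 0 (elemAddEuler π) (elemAddEuler ((2 : ℤ) • π)) = 0 := by
    rw [rnb_elemAddEuler (G := elemAddEuler _) π ((isSVF_ofElem _).add isSVF_euler)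
      fun n hn => elemAddEuler_of_two_le _ (by omega), zero_smul, add_zero]
    funext n ι x
    by_cases h : n = 0
    · subst h
      refine (elemAddEuler_one _ _ _).trans ?_
      have h0 : -dcons 0 ι 0 = 0 := neg_zero
      rw [h0, zero_smul, map_zero]
      rfl
    · exact elemAddEuler_of_two_le _ (by omega) _ _
  rw [hN, hK, rnb_elemAddEuler π hμs hμ3, rnb_elemAddEuler _ hμs hμ3, one_smul, hins, hins,
    rnb_elemAddEuler π (hB.add hμs) hB3, hadd, hins, hππ, h2π, one_smul]
  refine ⟨fun h => ?_, fun h => ⟨?_, hsq⟩⟩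
  · have h0 : ofElem E (l2 2 (fun _ => (0 : ℤ)) (fun _ => π)) = 0 := by
      have := h.1
      rw [two_smul, add_assoc, ← add_assoc (insElem π l2), add_eq_right] at this
      exact this
    simpa [ofElem] using congrFun (congrFun (congrFun h0 0) Fin.elim0) fun j => j.elim0
  · have h0 : ofElem E (0 : ⨁ i, E i) = 0 := by
      funext n ι x
      simp [ofElem]
    rw [h, h0, two_smul, zero_add, add_assoc]

end RN
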